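/- Let U ⊆ ℂ be a nonempty open connected set and let φ : ℂ → ℂ be twice continuously differentiable (over ℝ) on U. Then φ and φ² are harmonic on U if and only if φ is complex-differentiable on U or conj ∘ φ is complex-differentiable on U; that is, a function is holomorphic in the sense that φ and φ² are harmonic exactly when it is holomorphic or anti-holomorphic in the usual sense. -/

import Mathlib

/-- The Laplacian of a complex-valued function on `ℂ ≅ ℝ²`:
`Δh = ∂²h/∂x² + ∂²h/∂y²`, the second derivatives being taken along the
directions `1` and `I`. -/
noncomputable def lap2C (h : ℂ → ℂ) (z : ℂ) : ℂ :=
  fderiv ℝ (fun w => fderiv ℝ h w 1) z 1 +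
    fderiv ℝ (fun w => fderiv ℝ h w Complex.I) z Complex.I

open Complex InnerProductSpace in
theorem lap2C_eq_laplacian {f : ℂ → ℂ} {z : ℂ} (hf : ContDiffAt ℝ 2 f z) :
    lap2C f z = Laplacian.laplacian f z := by
  have hD : DifferentiableAt ℝ (fderiv ℝ f) z := by fun_prop
  rw [lap2C, laplacian_eq_iteratedFDeriv_complexPlane, fderiv_clm_apply hD (by fun_prop),
    fderiv_clm_apply hD (by fun_prop)]
  simp [iteratedFDeriv_two_apply]

open Complex in
/-- The Wirtinger derivative `∂f/∂x - i ∂f/∂y` of a harmonic function is complex-differentiable. -/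
theorem differentiableAt_wirtinger_of_lap2C_eq_zero {f : ℂ → ℂ} {z : ℂ}
    (hf : ContDiffAt ℝ 2 f z) (h : lap2C f z = 0) :
    DifferentiableAt ℂ (fun w => fderiv ℝ f w 1 - I * fderiv ℝ f w I) z := by
  have hD : DifferentiableAt ℝ (fderiv ℝ f) z := by fun_prop
  have h1 : HasFDerivAt (fun w => fderiv ℝ f w 1) ((fderiv ℝ (fderiv ℝ f) z).flip 1) z := by
    simpa using! hD.hasFDerivAt.clm_apply (hasFDerivAt_const (1 : ℂ) z)
  have hI : HasFDerivAt (fun w => fderiv ℝ f w I) ((fderiv ℝ (fderiv ℝ f) z).flip I) z := by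
    simpa using! hD.hasFDerivAt.clm_apply (hasFDerivAt_const I z)
  have hsymm := (hf.isSymmSndFDerivAt (by simp)).eq 1 I
  have hsub := h1.fun_sub (hI.const_mul I)
  rw [lap2C, h1.fderiv, hI.fderiv] at h
  refine differentiableAt_complex_iff_differentiableAt_real.2 ⟨hsub.differentiableAt, ?_⟩
  rw [hsub.fderiv]
  simp only [ContinuousLinearMap.flip_apply, sub_apply, smul_apply,
    smul_eq_mul] at h hsymm ⊢
  linear_combination -hsymm - I * h + fderiv ℝ (fderiv ℝ f) z 1 I * I_sq

open Complex in
theorem lap2C_sq {f : ℂ → ℂ} {z : ℂ} (hf : ContDiffAt ℝ 2 f z) :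
    lap2C (fun w => f w ^ 2) z =
      2 * f z * lap2C f z + 2 * (fderiv ℝ f z 1 ^ 2 + fderiv ℝ f z I ^ 2) := by
  have hD : DifferentiableAt ℝ (fderiv ℝ f) z := by fun_prop
  have hev : ∀ᶠ w in nhds z, DifferentiableAt ℝ f w := by
    filter_upwards [hf.eventually (by simp)] with w hw using hw.differentiableAt (by simp)
  have key (v : ℂ) : fderiv ℝ (fun w => fderiv ℝ (fun w => f w ^ 2) w v) z v =
      2 * f z * fderiv ℝ (fun w => fderiv ℝ f w v) z v + 2 * fderiv ℝ f z v ^ 2 := by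
    have heq : (fun w => fderiv ℝ (fun w => f w ^ 2) w v) =ᶠ[nhds z]
        fun w => 2 * (f w * fderiv ℝ f w v) := by
      filter_upwards [hev] with w hw
      rw [(hw.hasFDerivAt.pow 2).fderiv]
      simp [mul_assoc]
    have hDv : DifferentiableAt ℝ (fun w => fderiv ℝ f w v) z := by fun_prop
    rw [heq.fderiv_eq,
      ((hev.self_of_nhds.hasFDerivAt.fun_mul hDv.hasFDerivAt).const_mul (2 : ℂ)).fderiv]
    simp only [add_apply, smul_apply, smul_eq_mul]
    ring
  rw [lap2C, lap2C, key, key]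
  ring

theorem lap2C_conj_comp {f : ℂ → ℂ} {z : ℂ} (hf : ContDiffAt ℝ 2 f z) :
    lap2C (fun w => (starRingEnd ℂ) (f w)) z = (starRingEnd ℂ) (lap2C f z) := by
  have hconj : ContDiffAt ℝ 2 (fun w => (starRingEnd ℂ) (f w)) z :=
    Complex.conjCLE.contDiff.contDiffAt.comp z hf
  rw [lap2C_eq_laplacian hf, lap2C_eq_laplacian hconj]
  exact congrFun (InnerProductSpace.laplacian_CLE_comp_left (l := Complex.conjCLE) (f := f)) z

theorem lap2C_eq_zero_of_differentiableOn {f : ℂ → ℂ} {U : Set ℂ} (hU : IsOpen U)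
    (hf : DifferentiableOn ℂ f U) {z : ℂ} (hz : z ∈ U) : lap2C f z = 0 := by
  have h := (hf.analyticAt (hU.mem_nhds hz)).harmonicAt
  rw [lap2C_eq_laplacian h.1]
  exact h.2.eq_of_nhds

open Complex in
theorem fderiv_conj_comp {f : ℂ → ℂ} {z : ℂ} (hf : DifferentiableAt ℝ f z) (v : ℂ) :
    fderiv ℝ (fun w => (starRingEnd ℂ) (f w)) z v = (starRingEnd ℂ) (fderiv ℝ f z v) := by
  have h : HasFDerivAt (fun w => (starRingEnd ℂ) (f w))
      ((conjCLE : ℂ →L[ℝ] ℂ).comp (fderiv ℝ f z)) z :=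
    (conjCLE : ℂ →L[ℝ] ℂ).hasFDerivAt.comp z hf.hasFDerivAt
  rw [h.fderiv]
  rfl

theorem stmt19 (U : Set ℂ) (hU : IsOpen U) (hne : U.Nonempty)
    (hconn : IsPreconnected U) (φ : ℂ → ℂ) (hφ : ContDiffOn ℝ 2 φ U) :
    (∀ z ∈ U, lap2C φ z = 0 ∧ lap2C (fun w => (φ w) ^ 2) z = 0) ↔
    (DifferentiableOn ℂ φ U ∨
      DifferentiableOn ℂ (fun z => (starRingEnd ℂ) (φ z)) U) := by
  have hC {z : ℂ} (hz : z ∈ U) : ContDiffAt ℝ 2 φ z := hφ.contDiffAt (hU.mem_nhds hz)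
  have hCconj {z : ℂ} (hz : z ∈ U) : ContDiffAt ℝ 2 (fun w => (starRingEnd ℂ) (φ w)) z :=
    Complex.conjCLE.contDiff.contDiffAt.comp z (hC hz)
  have hd {z : ℂ} (hz : z ∈ U) : DifferentiableAt ℝ φ z := (hC hz).differentiableAt (by simp)
  constructor
  · intro h
    have hA : AnalyticOnNhd ℂ (fun w => fderiv ℝ φ w 1 - Complex.I * fderiv ℝ φ w Complex.I) U :=
      DifferentiableOn.analyticOnNhd (fun z hz => (differentiableAt_wirtinger_of_lap2C_eq_zero
        (hC hz) (h z hz).1).differentiableWithinAt) hU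
    have hB : AnalyticOnNhd ℂ (fun w => fderiv ℝ (fun w => (starRingEnd ℂ) (φ w)) w 1 -
        Complex.I * fderiv ℝ (fun w => (starRingEnd ℂ) (φ w)) w Complex.I) U :=
      DifferentiableOn.analyticOnNhd (fun z hz => (differentiableAt_wirtinger_of_lap2C_eq_zero
        (hCconj hz) (by rw [lap2C_conj_comp (hC hz), (h z hz).1, map_zero])).differentiableWithinAt)
        hU
    have hmul : ∀ z ∈ U, (fderiv ℝ φ z 1 - Complex.I * fderiv ℝ φ z Complex.I) *
        (fderiv ℝ (fun w => (starRingEnd ℂ) (φ w)) z 1 -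
          Complex.I * fderiv ℝ (fun w => (starRingEnd ℂ) (φ w)) z Complex.I) = 0 := by
      intro z hz
      have h2 := (h z hz).2
      rw [lap2C_sq (hC hz), (h z hz).1] at h2
      have h3 : (fderiv ℝ φ z 1 - Complex.I * fderiv ℝ φ z Complex.I) *
          (fderiv ℝ φ z 1 + Complex.I * fderiv ℝ φ z Complex.I) = 0 := by
        linear_combination h2 / 2 - fderiv ℝ φ z Complex.I ^ 2 * Complex.I_sq
      rw [fderiv_conj_comp (hd hz), fderiv_conj_comp (hd hz)]
      rcases mul_eq_zero.1 h3 with h4 | h4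
      · rw [h4, zero_mul]
      · have h5 := congrArg (starRingEnd ℂ) h4
        simp only [map_add, map_mul, Complex.conj_I, map_zero] at h5
        rw [sub_eq_add_neg, ← neg_mul, sub_eq_add_neg, ← neg_mul, h5, mul_zero]
    rcases hA.eq_zero_or_eq_zero_of_mul_eq_zero hB hmul hconn with h0 | h0
    · right
      intro z hz
      refine (differentiableAt_complex_iff_differentiableAt_real.2
        ⟨(hCconj hz).differentiableAt (by simp), ?_⟩).differentiableWithinAt
      have h5 := congrArg (starRingEnd ℂ) (h0 z hz)
      simp only [map_sub, map_mul, Complex.conj_I, map_zero] at h5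
      rw [fderiv_conj_comp (hd hz), fderiv_conj_comp (hd hz), smul_eq_mul]
      linear_combination -Complex.I * h5 +
        (starRingEnd ℂ) (fderiv ℝ φ z Complex.I) * Complex.I_sq
    · left
      intro z hz
      refine (differentiableAt_complex_iff_differentiableAt_real.2
        ⟨hd hz, ?_⟩).differentiableWithinAt
      have h4 := h0 z hz
      rw [fderiv_conj_comp (hd hz), fderiv_conj_comp (hd hz)] at h4
      have h5 := congrArg (starRingEnd ℂ) h4
      simp only [map_sub, map_mul, Complex.conj_I, map_zero, Complex.conj_conj] at h5
      rw [smul_eq_mul]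
      linear_combination -Complex.I * h5 + fderiv ℝ φ z Complex.I * Complex.I_sq
  · rintro (h | h) z hz
    · exact ⟨lap2C_eq_zero_of_differentiableOn hU h hz,
        lap2C_eq_zero_of_differentiableOn hU (h.pow 2) hz⟩
    · have h1 := lap2C_eq_zero_of_differentiableOn hU h hz
      have h2 := lap2C_eq_zero_of_differentiableOn hU (h.pow 2) hz
      rw [lap2C_conj_comp (hC hz), map_eq_zero] at h1
      have h3 := lap2C_conj_comp ((hC hz).pow 2)
      simp only [map_pow] at h3
      exact ⟨h1, (map_eq_zero (starRingEnd ℂ)).1 (h3.symm.trans h2)⟩
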